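/- Let P be a finite poset with a unique minimal element m, K a field, P⁺ = P ∪ {∞}, and let Λ be a translation on P⁺ with Λm = m. Let X = ⊕_{s∈S} X_s and Y = ⊕_{t∈T} Y_t be finite direct sums of convex representations of P, and set S_m = {s ∈ S : X_s(m) ≠ 0} and T_m = {t ∈ T : Y_t(m) ≠ 0}. If X and Y are (Λ,Λ)-interleaved, then ⊕_{s∈S_m} X_s and ⊕_{t∈T_m} Y_t are (Λ,Λ)-interleaved, and ⊕_{s∉S_m} X_s and ⊕_{t∉T_m} Y_t are (Λ,Λ)-interleaved. -/

import Mathlib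

namespace GPM

/-- A translation on a preorder: a monotone map `Λ` with `x ≤ Λ x` for all `x`. -/
structure Translation (Q : Type*) [Preorder Q] where
  toFun : Q → Q
  mono : Monotone toFun
  le_apply : ∀ x, x ≤ toFun x

/-- A subset `S` is connected if any two of its elements can be joined by a finite
sequence of elements of `S` in which consecutive elements are comparable. -/
def ConnectedIn {Q : Type*} [Preorder Q] (S : Set Q) : Prop :=
  ∀ x ∈ S, ∀ y ∈ S,
    Relation.ReflTransGen (fun a b => a ∈ S ∧ b ∈ S ∧ (a ≤ b ∨ b ≤ a)) x y

/-- A representation of a poset `P` with values in `K`-vector spaces. -/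
structure Rep (P : Type*) [Preorder P] (K : Type*) [Field K] where
  V : P → Type*
  [addCommGroup : ∀ p, AddCommGroup (V p)]
  [module : ∀ p, Module K (V p)]
  map : ∀ {p q : P}, p ≤ q → V p →ₗ[K] V q
  map_refl : ∀ p : P, map (le_refl p) = LinearMap.id
  map_comp : ∀ {p q r : P} (hpq : p ≤ q) (hqr : q ≤ r),
      (map hqr).comp (map hpq) = map (hpq.trans hqr)

attribute [instance] Rep.addCommGroup Rep.module

/-- A morphism of representations (a natural transformation). -/
structure RepHom {P : Type*} [Preorder P] {K : Type*} [Field K] (M N : Rep P K) where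
  app : ∀ p, M.V p →ₗ[K] N.V p
  natural : ∀ {p q : P} (h : p ≤ q), (N.map h).comp (app p) = (app q).comp (M.map h)

/-- The shift `MΛ : p ↦ M(Λ p)` of a representation by a translation. -/
def Rep.shift {P : Type*} [Preorder P] {K : Type*} [Field K]
    (M : Rep P K) (Λ : Translation P) : Rep P K where
  V p := M.V (Λ.toFun p)
  map h := M.map (Λ.mono h)
  map_refl p := M.map_refl (Λ.toFun p)
  map_comp h1 h2 := M.map_comp (Λ.mono h1) (Λ.mono h2)

/-- `(φ, ψ)` is a `(Λ, Γ)`-interleaving between `F` and `G`: `φ : F → GΛ`, `ψ : G → FΓ`,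
`ψΛ ∘ φ` is the canonical morphism `F → FΓΛ` and `φΓ ∘ ψ` is the canonical morphism
`G → GΛΓ`. -/
def IsInterleaving {P : Type*} [Preorder P] {K : Type*} [Field K]
    (Λ Γ : Translation P) (F G : Rep P K)
    (φ : RepHom F (G.shift Λ)) (ψ : RepHom G (F.shift Γ)) : Prop :=
  (∀ p, (ψ.app (Λ.toFun p)).comp (φ.app p)
      = F.map ((Λ.le_apply p).trans (Γ.le_apply (Λ.toFun p)))) ∧
  (∀ p, (φ.app (Γ.toFun p)).comp (ψ.app p)
      = G.map ((Γ.le_apply p).trans (Λ.le_apply (Γ.toFun p))))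

/-- `F` and `G` are `(Λ, Γ)`-interleaved. -/
def Interleaved {P : Type*} [Preorder P] {K : Type*} [Field K]
    (Λ Γ : Translation P) (F G : Rep P K) : Prop :=
  ∃ φ ψ, IsInterleaving Λ Γ F G φ ψ

/-- The submodule of `K` underlying the convex representation of `S` at the point `p`:
all of `K` on `S`, and `0` off `S`. -/
noncomputable def convexSub (K : Type*) [Field K] {Q : Type*} (S : Set Q) (p : Q) :
    Submodule K K :=
  @ite _ (p ∈ S) (Classical.dec _) ⊤ ⊥

theorem convexSub_pos (K : Type*) [Field K] {Q : Type*} {S : Set Q} {p : Q} (h : p ∈ S) :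
    convexSub K S p = ⊤ := by
  rw [convexSub, if_pos h]

theorem convexSub_neg (K : Type*) [Field K] {Q : Type*} {S : Set Q} {p : Q} (h : p ∉ S) :
    convexSub K S p = ⊥ := by
  rw [convexSub, if_neg h]

/-- The canonical map between the fibers of the convex representations of `S` and `T`:
the identity of `K` when both fibers are `K`, and zero otherwise. -/
noncomputable def phiMap (K : Type*) [Field K] {Q : Type*} (S T : Set Q) (p q : Q) :
    ↥(convexSub K S p) →ₗ[K] ↥(convexSub K T q) :=
  @dite _ (p ∈ S ∧ q ∈ T) (Classical.dec _)
    (fun h => Submodule.inclusion (le_of_eq (by rw [convexSub_pos K h.1, convexSub_pos K h.2])))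
    (fun _ => 0)

theorem phiMap_neg (K : Type*) [Field K] {Q : Type*} {S T : Set Q} {p q : Q}
    (h : ¬(p ∈ S ∧ q ∈ T)) : phiMap K S T p q = 0 := by
  rw [phiMap, dif_neg h]

/-- The convex representation with support the interval-convex set `S`:
`K` at points of `S`, `0` elsewhere, with identity structure maps inside `S`. -/
noncomputable def convexRep (K : Type*) [Field K] {Q : Type*} [Preorder Q]
    (S : Set Q) (hS : S.OrdConnected) : Rep Q K where
  V p := ↥(convexSub K S p)
  map {p q} _ := phiMap K S S p q
  map_refl p := by
    show phiMap K S S p p = LinearMap.id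
    by_cases hp : p ∈ S
    · rw [phiMap, dif_pos ⟨hp, hp⟩]
      rfl
    · rw [phiMap_neg (K := K) (by tauto)]
      apply LinearMap.ext
      intro x
      have hx : x = 0 := by
        apply Subtype.ext
        have hle : convexSub K S p ≤ ⊥ := le_of_eq (convexSub_neg K hp)
        simpa using hle x.2
      simp [hx]
  map_comp {p q r} hpq hqr := by
    show (phiMap K S S q r).comp (phiMap K S S p q) = phiMap K S S p r
    by_cases hp : p ∈ S
    · by_cases hr : r ∈ S
      · have hq : q ∈ S := hS.out hp hr ⟨hpq, hqr⟩
        rw [phiMap, phiMap, phiMap, dif_pos ⟨hq, hr⟩, dif_pos ⟨hp, hq⟩, dif_pos ⟨hp, hr⟩]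
        rfl
      · rw [phiMap_neg (K := K) (S := S) (T := S) (p := q) (q := r) (by tauto),
          phiMap_neg (K := K) (S := S) (T := S) (p := p) (q := r) (by tauto)]
        simp
    · rw [phiMap_neg (K := K) (S := S) (T := S) (p := p) (q := q) (by tauto),
        phiMap_neg (K := K) (S := S) (T := S) (p := p) (q := r) (by tauto)]
      simp

/-- Direct sum of a (finite) family of representations. -/
def Rep.dfsum {P : Type*} [Preorder P] {K : Type*} [Field K]
    {ι : Type*} (X : ι → Rep P K) : Rep P K where
  V p := ∀ i, (X i).V p
  map h := LinearMap.pi fun i => ((X i).map h).comp (LinearMap.proj i)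
  map_refl p := by
    apply LinearMap.ext
    intro x
    funext i
    simp [(X i).map_refl]
  map_comp h1 h2 := by
    apply LinearMap.ext
    intro x
    funext i
    have := congrArg (fun f => f (x i)) ((X i).map_comp h1 h2)
    simp only [LinearMap.comp_apply] at this
    simpa using this

section Blocks

variable {P : Type*} [Preorder P] {K : Type*} [Field K] {ι κ : Type*}

open Classical in
/-- The inclusion, at the point `p`, of the direct sum of the summands satisfying `A` into the
whole direct sum. -/
noncomputable def Rep.extendZero (X : ι → Rep P K) (A : ι → Prop) (p : P) :
    (Rep.dfsum fun i : {i // A i} => X i.1).V p →ₗ[K] (Rep.dfsum X).V p :=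
  LinearMap.pi fun i =>
    if h : A i then LinearMap.proj (R := K) (φ := fun i : {i // A i} => (X i.1).V p) ⟨i, h⟩ else 0

open Classical in
theorem Rep.extendZero_pos (X : ι → Rep P K) {A : ι → Prop} {p : P}
    (v : (Rep.dfsum fun i : {i // A i} => X i.1).V p) {i : ι} (h : A i) :
    Rep.extendZero X A p v i = v ⟨i, h⟩ := by
  change (dite (A i) (fun h => LinearMap.proj (R := K) (φ := fun i : {i // A i} => (X i.1).V p)
    ⟨i, h⟩) fun _ => 0 : _ →ₗ[K] (X i).V p) v = _
  rw [dif_pos h]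
  rfl

open Classical in
theorem Rep.extendZero_neg (X : ι → Rep P K) {A : ι → Prop} {p : P}
    (v : (Rep.dfsum fun i : {i // A i} => X i.1).V p) {i : ι} (h : ¬A i) :
    Rep.extendZero X A p v i = 0 := by
  change (dite (A i) (fun h => LinearMap.proj (R := K) (φ := fun i : {i // A i} => (X i.1).V p)
    ⟨i, h⟩) fun _ => 0 : _ →ₗ[K] (X i).V p) v = _
  rw [dif_neg h]
  rfl

theorem Rep.map_extendZero (X : ι → Rep P K) (A : ι → Prop) {p q : P} (h : p ≤ q)
    (v : (Rep.dfsum fun i : {i // A i} => X i.1).V p) :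
    (Rep.dfsum X).map h (Rep.extendZero X A p v) =
      Rep.extendZero X A q ((Rep.dfsum fun i : {i // A i} => X i.1).map h v) := by
  funext i
  change (X i).map h (Rep.extendZero X A p v i) = _
  by_cases hi : A i
  · rw [Rep.extendZero_pos X _ hi, Rep.extendZero_pos X _ hi]
    rfl
  · rw [Rep.extendZero_neg X _ hi, Rep.extendZero_neg X _ hi, map_zero]

/-- The block of a morphism between direct sums given by the summands of the source satisfying
`A` and those of the target satisfying `B`. -/
noncomputable def RepHom.block {Λ : Translation P} {X : ι → Rep P K} {Y : κ → Rep P K}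
    (φ : RepHom (Rep.dfsum X) ((Rep.dfsum Y).shift Λ)) (A : ι → Prop) (B : κ → Prop) :
    RepHom (Rep.dfsum fun i : {i // A i} => X i.1)
      ((Rep.dfsum fun j : {j // B j} => Y j.1).shift Λ) where
  app p := LinearMap.pi fun j : {j // B j} =>
    (LinearMap.proj (R := K) (φ := fun j => (Y j).V (Λ.toFun p)) j.1).comp
      ((φ.app p).comp (Rep.extendZero X A p))
  natural {p q} h := by
    refine LinearMap.ext fun v => funext fun j => ?_
    have h₁ := congrFun (LinearMap.congr_fun (φ.natural h) (Rep.extendZero X A p v)) j.1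
    exact h₁.trans (congrFun (congrArg (φ.app q) (Rep.map_extendZero X A h v)) j.1)

/-- A morphism between direct sums sends vectors supported on the summands satisfying `A` to
vectors supported on the summands satisfying `B`. -/
def RepHom.PreservesSupport {Λ : Translation P} {X : ι → Rep P K} {Y : κ → Rep P K}
    (φ : RepHom (Rep.dfsum X) ((Rep.dfsum Y).shift Λ)) (A : ι → Prop) (B : κ → Prop) : Prop :=
  ∀ (p : P) (v : (Rep.dfsum X).V p), (∀ i, ¬A i → v i = 0) →
    ∀ j, ¬B j → (φ.app p v : (Rep.dfsum Y).V (Λ.toFun p)) j = 0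

theorem RepHom.block_comp_block {Λ Γ : Translation P} {X : ι → Rep P K} {Y : κ → Rep P K}
    {φ : RepHom (Rep.dfsum X) ((Rep.dfsum Y).shift Λ)}
    {ψ : RepHom (Rep.dfsum Y) ((Rep.dfsum X).shift Γ)} {A : ι → Prop} {B : κ → Prop}
    (h : φ.PreservesSupport A B) {p : P} {hp : p ≤ Γ.toFun (Λ.toFun p)}
    (hφψ : (ψ.app (Λ.toFun p)).comp (φ.app p) = (Rep.dfsum X).map hp) :
    ((ψ.block B A).app (Λ.toFun p)).comp ((φ.block A B).app p) =
      (Rep.dfsum fun i : {i // A i} => X i.1).map hp := by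
  refine LinearMap.ext fun v => funext fun i => ?_
  have h₁ : Rep.extendZero Y B (Λ.toFun p) ((φ.block A B).app p v) =
      φ.app p (Rep.extendZero X A p v) := by
    funext j
    by_cases hj : B j
    · exact Rep.extendZero_pos Y _ hj
    · exact (Rep.extendZero_neg Y _ hj).trans
        (h p _ (fun i hi => Rep.extendZero_neg X v hi) j hj).symm
  have h₂ := congrFun (LinearMap.congr_fun hφψ (Rep.extendZero X A p v)) i.1
  have h₃ := congrFun (Rep.map_extendZero X A hp v) i.1
  exact (congrFun (congrArg (ψ.app (Λ.toFun p)) h₁) i.1).trans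
    (h₂.trans (h₃.trans (Rep.extendZero_pos X _ i.2)))

theorem RepHom.block_compl_comp_block_compl {Λ Γ : Translation P} {X : ι → Rep P K}
    {Y : κ → Rep P K} {φ : RepHom (Rep.dfsum X) ((Rep.dfsum Y).shift Λ)}
    {ψ : RepHom (Rep.dfsum Y) ((Rep.dfsum X).shift Γ)} {A : ι → Prop} {B : κ → Prop}
    (h : ψ.PreservesSupport B A) {p : P} {hp : p ≤ Γ.toFun (Λ.toFun p)}
    (hφψ : (ψ.app (Λ.toFun p)).comp (φ.app p) = (Rep.dfsum X).map hp) :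
    ((ψ.block (fun j => ¬B j) (fun i => ¬A i)).app (Λ.toFun p)).comp
        ((φ.block (fun i => ¬A i) (fun j => ¬B j)).app p) =
      (Rep.dfsum fun i : {i // ¬A i} => X i.1).map hp := by
  refine LinearMap.ext fun v => funext fun i => ?_
  let w : (Rep.dfsum Y).V (Λ.toFun p) := φ.app p (Rep.extendZero X _ p v)
  let w' : (Rep.dfsum Y).V (Λ.toFun p) := Rep.extendZero Y (fun j => ¬B j) (Λ.toFun p)
    ((φ.block (fun i => ¬A i) (fun j => ¬B j)).app p v)
  have h₁ : ∀ j, ¬B j → (w - w') j = 0 := by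
    intro j hj
    have h' : w' j = w j := Rep.extendZero_pos Y (A := fun j => ¬B j) _ hj
    exact sub_eq_zero.mpr h'.symm
  have h₂ := h _ _ h₁ i.1 i.2
  have h₃ := sub_eq_zero.mp
    ((congrFun (map_sub (ψ.app (Λ.toFun p)) w w') i.1).symm.trans h₂)
  have h₄ := congrFun (LinearMap.congr_fun hφψ (Rep.extendZero X (fun i => ¬A i) p v)) i.1
  have h₅ := congrFun (Rep.map_extendZero X (fun i => ¬A i) hp v) i.1
  exact h₃.symm.trans (h₄.trans (h₅.trans (Rep.extendZero_pos X (A := fun i => ¬A i) _ i.2)))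

theorem convexRep_V_eq_zero {S : Set P} (hS : S.OrdConnected) {p : P} (hp : p ∉ S)
    (v : (convexRep K S hS).V p) : v = 0 :=
  Subtype.ext ((Submodule.mem_bot K).mp ((convexSub_neg K hp).le v.2))

theorem convexRep_map_surjective {S : Set P} (hS : S.OrdConnected) {p q : P} (hpq : p ≤ q)
    (hp : p ∈ S) : Function.Surjective ((convexRep K S hS).map hpq) := by
  intro v
  by_cases hq : q ∈ S
  · refine ⟨⟨v.1, (convexSub_pos K hp).ge trivial⟩, ?_⟩
    change phiMap K S S p q _ = v
    rw [phiMap, dif_pos ⟨hp, hq⟩]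
    rfl
  · exact ⟨0, by rw [map_zero, convexRep_V_eq_zero hS hq v]⟩

/-- If `m` is a least element fixed by `Λ`, there are no nonzero morphisms from a convex
representation supported at `m` to the shift of one that is not. -/
theorem RepHom.preservesSupport_of_isLeast {Λ : Translation P} {m : P} (hm : ∀ p, m ≤ p)
    (hΛm : Λ.toFun m = m) {S : ι → Set P} {T : κ → Set P}
    (hS : ∀ i, (S i).OrdConnected) (hT : ∀ j, (T j).OrdConnected)
    (φ : RepHom (Rep.dfsum fun i => convexRep K (S i) (hS i))
      ((Rep.dfsum fun j => convexRep K (T j) (hT j)).shift Λ)) :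
    φ.PreservesSupport (fun i => m ∈ S i) (fun j => m ∈ T j) := by
  intro p v hv j hj
  have hu : ∀ i, ∃ u, (convexRep K (S i) (hS i)).map (hm p) u = v i := by
    intro i
    by_cases hi : m ∈ S i
    · exact convexRep_map_surjective (hS i) (hm p) hi (v i)
    · exact ⟨0, by rw [map_zero, hv i hi]⟩
  choose u hu using hu
  have huv : (Rep.dfsum fun i => convexRep K (S i) (hS i)).map (hm p) u = v := funext hu
  have h₁ := congrFun (LinearMap.congr_fun (φ.natural (hm p)) u) j
  refine ((h₁.trans (congrFun (congrArg (φ.app p) huv) j)).symm).trans ?_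
  have h₂ : (φ.app m u : (Rep.dfsum fun j => convexRep K (T j) (hT j)).V (Λ.toFun m)) j = 0 :=
    convexRep_V_eq_zero (hT j) (by rwa [hΛm]) _
  change (convexRep K (T j) (hT j)).map (Λ.mono (hm p))
    ((φ.app m u : (Rep.dfsum fun j => convexRep K (T j) (hT j)).V (Λ.toFun m)) j) = 0
  exact (congrArg _ h₂).trans (map_zero _)

end Blocks

/-- Let `P` be a finite poset with unique minimal element `m`, `Λ` a
translation on `P⁺ = P ∪ {∞}` with `Λ m = m`, and `X = ⊕ᵢ Xᵢ`, `Y = ⊕ⱼ Yⱼ` finite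
direct sums of convex representations of `P`.  If `X` and `Y` are `(Λ,Λ)`-interleaved,
then so are the sums of the summands supported at `m`, and the sums of the summands not
supported at `m`. -/
theorem statement15 {P : Type*} [PartialOrder P] [Finite P] (m : P)
    (hm : IsMin m) (hmuniq : ∀ p : P, IsMin p → p = m)
    {K : Type*} [Field K]
    (Λ : Translation (WithTop P)) (hΛm : Λ.toFun ↑m = ↑m)
    {ι κ : Type*} [Finite ι] [Finite κ]
    (S : ι → Set (WithTop P)) (T : κ → Set (WithTop P))
    (hSne : ∀ i, (S i).Nonempty) (hSconn : ∀ i, ConnectedIn (S i))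
    (hSconv : ∀ i, (S i).OrdConnected) (hStop : ∀ i, (⊤ : WithTop P) ∉ S i)
    (hTne : ∀ j, (T j).Nonempty) (hTconn : ∀ j, ConnectedIn (T j))
    (hTconv : ∀ j, (T j).OrdConnected) (hTtop : ∀ j, (⊤ : WithTop P) ∉ T j)
    (hint : Interleaved Λ Λ (Rep.dfsum fun i => convexRep K (S i) (hSconv i))
        (Rep.dfsum fun j => convexRep K (T j) (hTconv j))) :
    Interleaved Λ Λ
        (Rep.dfsum fun i : {i : ι // (↑m : WithTop P) ∈ S i} =>
          convexRep K (S i.1) (hSconv i.1))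
        (Rep.dfsum fun j : {j : κ // (↑m : WithTop P) ∈ T j} =>
          convexRep K (T j.1) (hTconv j.1)) ∧
      Interleaved Λ Λ
        (Rep.dfsum fun i : {i : ι // (↑m : WithTop P) ∉ S i} =>
          convexRep K (S i.1) (hSconv i.1))
        (Rep.dfsum fun j : {j : κ // (↑m : WithTop P) ∉ T j} =>
          convexRep K (T j.1) (hTconv j.1)) := by
  have hle : ∀ p : WithTop P, (m : WithTop P) ≤ p := by
    intro p
    induction p with
    | top => exact le_top
    | coe p =>
      obtain ⟨b, hbp, hb⟩ := (Set.toFinite (Set.univ : Set P)).exists_le_minimal (Set.mem_univ p)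
      have hbm : b = m := hmuniq b fun c hc => hb.2 (Set.mem_univ c) hc
      exact WithTop.coe_le_coe.mpr (hbm ▸ hbp)
  obtain ⟨φ, ψ, hφψ, hψφ⟩ := hint
  have hφ := φ.preservesSupport_of_isLeast hle hΛm hSconv hTconv
  have hψ := ψ.preservesSupport_of_isLeast hle hΛm hTconv hSconv
  exact ⟨⟨φ.block _ _, ψ.block _ _, fun p => RepHom.block_comp_block hφ (hφψ p),
      fun p => RepHom.block_comp_block hψ (hψφ p)⟩,
    ⟨φ.block _ _, ψ.block _ _, fun p => RepHom.block_compl_comp_block_compl hψ (hφψ p),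
      fun p => RepHom.block_compl_comp_block_compl hφ (hψφ p)⟩⟩

end GPM
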